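/- (Proposition 3, time-domain form: exactness of the affine Jacobi fractional differentiator.) Let n, k ∈ ℕ, let μ > -1 and α be real numbers with n < α ≤ n+1, let T > 0, t₀ ∈ ℝ, and let a₀, …, a_n, b, c be real numbers. Define x_{2α-n}(t₀+t) := Σ_{j=0}^{n} (t^j/j!) a_j + (t^α/Γ(α+1)) b + (t^{2α-n}/Γ(2α-n+1)) c for t ≥ 0. For real parameters κ > -1, ν > -1, define the minimal Jacobi fractional differentiator D_{κ,ν}(f) := (n+1)!/T^α · (Γ(α-n)/B(α+1+κ, n+ν+2)) · ∫_0^1 (1-τ)^ν τ^κ P_{n+1}^{(ν,κ)}(τ) f(t₀+Tτ) dτ. Set λ := (2α-n+1+k)/(α-n). Then λ D_{k,μ+1}(x_{2α-n}) + (1-λ) D_{k+1,μ}(x_{2α-n}) = b. -/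

import Mathlib

open Real

/-- Generalized binomial coefficient `binom(a, i) = Γ(a+1)/(Γ(i+1) Γ(a-i+1))`. -/
noncomputable def gbinom (a : ℝ) (i : ℕ) : ℝ :=
  Real.Gamma (a + 1) / (Real.Gamma (i + 1) * Real.Gamma (a - i + 1))

/-- Shifted Jacobi polynomial on `[0,1]`. -/
noncomputable def jacobiP (μ k : ℝ) (m : ℕ) (τ : ℝ) : ℝ :=
  ∑ j ∈ Finset.range (m + 1),
    gbinom (m + μ) j * gbinom (m + k) (m - j) * (τ - 1) ^ (m - j) * τ ^ j

/-- Beta function `B(p,q) = Γ(p)Γ(q)/Γ(p+q)`. -/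
noncomputable def betaFn (p q : ℝ) : ℝ :=
  Real.Gamma p * Real.Gamma q / Real.Gamma (p + q)

/-- Minimal Jacobi fractional differentiator with parameters `κ, ν`. -/
noncomputable def minDiff (n : ℕ) (α T t₀ κ ν : ℝ) (f : ℝ → ℝ) : ℝ :=
  (Nat.factorial (n + 1) : ℝ) / T ^ α
    * (Real.Gamma (α - n) / betaFn (α + 1 + κ) (n + ν + 2))
    * ∫ τ in (0 : ℝ)..1, (1 - τ) ^ ν * τ ^ κ * jacobiP ν κ (n + 1) τ * f (t₀ + T * τ)

open MeasureTheory Set Finset Polynomial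

theorem betaFn_pos {p q : ℝ} (hp : 0 < p) (hq : 0 < q) : 0 < betaFn p q :=
  ProbabilityTheory.beta_pos hp hq

theorem ofReal_beta_integrand {p q τ : ℝ} (hτ : τ ∈ Ioo (0 : ℝ) 1) :
    (τ : ℂ) ^ ((p : ℂ) - 1) * (1 - (τ : ℂ)) ^ ((q : ℂ) - 1)
      = ((τ ^ (p - 1) * (1 - τ) ^ (q - 1) : ℝ) : ℂ) := by
  have h1 : (0 : ℝ) ≤ 1 - τ := by linarith [hτ.2]
  rw [Complex.ofReal_mul, Complex.ofReal_cpow hτ.1.le, Complex.ofReal_cpow h1]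
  push_cast
  rfl

theorem integrableOn_beta_integrand {p q : ℝ} (hp : 0 < p) (hq : 0 < q) :
    IntegrableOn (fun τ : ℝ => τ ^ (p - 1) * (1 - τ) ^ (q - 1)) (Ioo 0 1) := by
  have h := Complex.betaIntegral_convergent (u := p) (v := q) (by simpa) (by simpa)
  rw [intervalIntegrable_iff_integrableOn_Ioo_of_le zero_le_one] at h
  have h' := h.congr_fun (fun τ hτ => ofReal_beta_integrand hτ) measurableSet_Ioo
  exact h'.re

theorem integral_beta_integrand {p q : ℝ} (hp : 0 < p) (hq : 0 < q) :
    ∫ τ in Ioo (0 : ℝ) 1, τ ^ (p - 1) * (1 - τ) ^ (q - 1) = betaFn p q := by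
  have h := ProbabilityTheory.beta_eq_betaIntegralReal p q hp hq
  rw [Complex.betaIntegral, intervalIntegral.integral_of_le zero_le_one,
    integral_Ioc_eq_integral_Ioo,
    setIntegral_congr_fun measurableSet_Ioo (fun τ hτ => ofReal_beta_integrand hτ),
    integral_complex_ofReal, Complex.ofReal_re] at h
  exact h.symm

/-- Iterated forward differences of a quotient of Gamma functions. -/
theorem fwdDiff_iter_Gamma_div_Gamma (s : ℝ) (m : ℕ) {y : ℝ} (hy : 0 < y + 1)
    (hsy : 0 < s + y + 1) :
    (fwdDiff (1 : ℝ))^[m] (fun z => Gamma (s + z + 1) / Gamma (z + 1)) y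
      = (descPochhammer ℝ m).eval s * Gamma (s + y + 1) / Gamma (y + m + 1) := by
  induction m generalizing y with
  | zero => simp
  | succ m ih =>
    have hm : 0 < y + m + 1 := by
      have : (0 : ℝ) ≤ m := m.cast_nonneg
      linarith
    rw [Function.iterate_succ_apply', fwdDiff, ih (by linarith) (by linarith), ih hy hsy,
      descPochhammer_succ_eval]
    have e1 : s + (y + 1) + 1 = (s + y + 1) + 1 := by ring
    have e2 : y + 1 + m + 1 = (y + m + 1) + 1 := by ring
    have e3 : y + (m + 1 : ℕ) + 1 = (y + m + 1) + 1 := by push_cast; ring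
    rw [e1, e2, e3, Gamma_add_one hsy.ne', Gamma_add_one hm.ne']
    have := (Gamma_pos_of_pos hm).ne'
    field_simp
    ring

theorem sum_neg_one_pow_choose_Gamma_div_Gamma (s : ℝ) (m : ℕ) {y : ℝ} (hy : 0 < y + 1)
    (hsy : 0 < s + y + 1) :
    ∑ j ∈ range (m + 1),
        (-1 : ℝ) ^ (m - j) * m.choose j * (Gamma (s + y + j + 1) / Gamma (y + j + 1))
      = (descPochhammer ℝ m).eval s * Gamma (s + y + 1) / Gamma (y + m + 1) := by
  rw [← fwdDiff_iter_Gamma_div_Gamma s m hy hsy, fwdDiff_iter_eq_sum_shift]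
  refine sum_congr rfl fun j _ => ?_
  simp [add_assoc]

theorem Gamma_add_one_eq_descPochhammer_mul (s : ℝ) (m : ℕ) (h : 0 < s - m + 1) :
    Gamma (s + 1) = (descPochhammer ℝ m).eval s * Gamma (s - m + 1) := by
  induction m with
  | zero => simp
  | succ m ih =>
    push_cast at h
    rw [ih (by linarith), descPochhammer_succ_eval, Gamma_add_one (by linarith : s - m ≠ 0)]
    push_cast
    rw [show s - (m + 1 : ℝ) + 1 = s - m by ring]
    ring

theorem gbinom_mul_gbinom_mul_betaFn {κ ν s : ℝ} (hν : -1 < ν) {m j : ℕ}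
    (hj : j ≤ m) :
    gbinom (m + ν) j * gbinom (m + κ) (m - j) * betaFn (s + κ + j + 1) (ν + (m - j : ℕ) + 1)
      = Gamma (m + ν + 1) * Gamma (m + κ + 1) / (m.factorial * Gamma (s + κ + ν + m + 2))
        * (m.choose j * (Gamma (s + κ + j + 1) / Gamma (κ + j + 1))) := by
  obtain ⟨d, rfl⟩ := Nat.exists_eq_add_of_le hj
  have hf : ((j + d).factorial : ℝ) = (j + d).choose j * j.factorial * d.factorial := by
    have := Nat.choose_mul_factorial_mul_factorial (Nat.le_add_right j d)
    rw [Nat.add_sub_cancel_left] at this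
    exact_mod_cast this.symm
  have hc : ((j + d).choose j : ℝ) ≠ 0 := by
    exact_mod_cast (Nat.choose_pos (Nat.le_add_right j d)).ne'
  have h1 : Gamma (ν + d + 1) ≠ 0 := (Gamma_pos_of_pos (by
    have : (0 : ℝ) ≤ d := d.cast_nonneg
    linarith)).ne'
  have e1 : ((j + d : ℕ) : ℝ) + ν - j + 1 = ν + d + 1 := by push_cast; ring
  have e2 : ((j + d : ℕ) : ℝ) + κ - d + 1 = κ + j + 1 := by push_cast; ring
  have e3 : s + κ + j + 1 + (ν + d + 1) = s + κ + ν + (j + d : ℕ) + 2 := by push_cast; ring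
  rw [Nat.add_sub_cancel_left, gbinom, gbinom, betaFn, e1, e2, e3, Gamma_nat_eq_factorial,
    Gamma_nat_eq_factorial, hf]
  have := d.factorial_ne_zero
  have := j.factorial_ne_zero
  field_simp

theorem jacobi_integrand_eq {κ ν s : ℝ} (m : ℕ) {τ : ℝ} (hτ : τ ∈ Ioo (0 : ℝ) 1) :
    (1 - τ) ^ ν * τ ^ κ * jacobiP ν κ m τ * τ ^ s
      = ∑ j ∈ range (m + 1), (gbinom (m + ν) j * gbinom (m + κ) (m - j) * (-1) ^ (m - j))
        * (τ ^ (s + κ + j + 1 - 1) * (1 - τ) ^ (ν + (m - j : ℕ) + 1 - 1)) := by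
  have h1 : 0 < 1 - τ := by linarith [hτ.2]
  rw [jacobiP, mul_sum, sum_mul]
  refine sum_congr rfl fun j _ => ?_
  rw [add_sub_cancel_right, add_sub_cancel_right, rpow_add hτ.1, rpow_add hτ.1, rpow_add h1,
    rpow_natCast, rpow_natCast, ← neg_sub 1 τ, neg_pow (1 - τ)]
  ring

theorem integrableOn_jacobi_moment {κ ν s : ℝ} (hκ : -1 < κ) (hν : -1 < ν) (hs : 0 ≤ s)
    (m : ℕ) :
    IntegrableOn (fun τ : ℝ => (1 - τ) ^ ν * τ ^ κ * jacobiP ν κ m τ * τ ^ s) (Ioo 0 1) := by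
  refine IntegrableOn.congr_fun ?_ (fun τ hτ => (jacobi_integrand_eq m hτ).symm) measurableSet_Ioo
  refine integrable_finsetSum _ fun j _ => Integrable.const_mul
    (integrableOn_beta_integrand ?_ ?_) _
  · have : (0 : ℝ) ≤ j := j.cast_nonneg
    linarith
  · have : (0 : ℝ) ≤ (m - j : ℕ) := Nat.cast_nonneg _
    linarith

/-- Moments of the shifted Jacobi polynomials against the Jacobi weight. -/
theorem integral_jacobi_moment {κ ν s : ℝ} (hκ : -1 < κ) (hν : -1 < ν) (hs : 0 ≤ s) (m : ℕ) :
    ∫ τ in Ioo (0 : ℝ) 1, (1 - τ) ^ ν * τ ^ κ * jacobiP ν κ m τ * τ ^ s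
      = (descPochhammer ℝ m).eval s / m.factorial * betaFn (s + κ + 1) (m + ν + 1) := by
  have hp (j : ℕ) : 0 < s + κ + j + 1 := by
    have : (0 : ℝ) ≤ j := j.cast_nonneg
    linarith
  have hq (j : ℕ) : 0 < ν + j + 1 := by
    have : (0 : ℝ) ≤ j := j.cast_nonneg
    linarith
  rw [setIntegral_congr_fun measurableSet_Ioo (fun τ hτ => jacobi_integrand_eq m hτ),
    integral_finsetSum _ fun j _ => Integrable.const_mul
      (integrableOn_beta_integrand (hp j) (hq (m - j))) _]
  simp_rw [integral_const_mul]
  have hterm (j : ℕ) (hj : j ∈ range (m + 1)) :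
      gbinom (m + ν) j * gbinom (m + κ) (m - j) * (-1) ^ (m - j)
        * ∫ τ in Ioo (0 : ℝ) 1,
            τ ^ (s + κ + j + 1 - 1) * (1 - τ) ^ (ν + (m - j : ℕ) + 1 - 1)
      = Gamma (m + ν + 1) * Gamma (m + κ + 1) / (m.factorial * Gamma (s + κ + ν + m + 2))
        * ((-1) ^ (m - j) * m.choose j * (Gamma (s + κ + j + 1) / Gamma (κ + j + 1))) := by
    rw [integral_beta_integrand (hp j) (hq (m - j)), mul_right_comm,
      gbinom_mul_gbinom_mul_betaFn hν (mem_range_succ_iff.mp hj)]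
    ring
  have hG : Gamma (κ + m + 1) ≠ 0 := (Gamma_pos_of_pos (by
    have : (0 : ℝ) ≤ m := m.cast_nonneg
    linarith)).ne'
  rw [sum_congr rfl hterm, ← mul_sum,
    sum_neg_one_pow_choose_Gamma_div_Gamma s m (by linarith) (by linarith), betaFn,
    show s + κ + 1 + (m + ν + 1) = s + κ + ν + m + 2 by ring, add_comm (m : ℝ) κ]
  field_simp

/-- On a truncated fractional Taylor model, the minimal differentiator returns the coefficient
of order `α` up to an explicit multiple of the coefficient of order `2 * α - n`. -/
theorem minDiff_eq_add {n : ℕ} {α T t₀ κ ν : ℝ} (hκ : -1 < κ) (hν : -1 < ν)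
    (hα : (n : ℝ) < α) (hT : 0 < T) {a : ℕ → ℝ} {b c : ℝ} {x : ℝ → ℝ}
    (hx : ∀ t : ℝ, 0 ≤ t →
      x (t₀ + t) = (∑ j ∈ range (n + 1), t ^ j / (Nat.factorial j) * a j)
        + t ^ α / Gamma (α + 1) * b
        + t ^ (2 * α - n) / Gamma (2 * α - n + 1) * c) :
    minDiff n α T t₀ κ ν x = b + T ^ (2 * α - n) / T ^ α * Gamma (α - n) / Gamma (2 * (α - n)) * c
      * (betaFn (2 * α - n + κ + 1) (n + ν + 2) / betaFn (α + 1 + κ) (n + ν + 2)) := by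
  have hn : (0 : ℝ) ≤ n := n.cast_nonneg
  have hα0 : 0 ≤ α := by linarith
  have hβ0 : 0 ≤ 2 * α - n := by linarith
  let w : ℝ → ℝ := fun τ => (1 - τ) ^ ν * τ ^ κ * jacobiP ν κ (n + 1) τ
  have hw {s : ℝ} (hs : 0 ≤ s) (C : ℝ) : IntegrableOn (fun τ => C * (w τ * τ ^ s)) (Ioo 0 1) :=
    (integrableOn_jacobi_moment hκ hν hs (n + 1)).const_mul C
  have hI {s : ℝ} (hs : 0 ≤ s) : ∫ τ in Ioo (0 : ℝ) 1, w τ * τ ^ s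
      = (descPochhammer ℝ (n + 1)).eval s / (n + 1).factorial
        * betaFn (s + κ + 1) (n + ν + 2) := by
    rw [integral_jacobi_moment hκ hν hs (n + 1)]
    push_cast
    congr 2
    ring
  have hexp : ∀ τ ∈ Ioo (0 : ℝ) 1, w τ * x (t₀ + T * τ)
      = (∑ j ∈ range (n + 1), T ^ j / j.factorial * a j * (w τ * τ ^ (j : ℝ)))
        + T ^ α / Gamma (α + 1) * b * (w τ * τ ^ α)
        + T ^ (2 * α - n) / Gamma (2 * α - n + 1) * c * (w τ * τ ^ (2 * α - n)) := by
    intro τ hτ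
    rw [hx _ (mul_nonneg hT.le hτ.1.le), mul_add, mul_add, mul_sum,
      mul_rpow hT.le hτ.1.le, mul_rpow hT.le hτ.1.le]
    congr 1
    · congr 1
      · refine sum_congr rfl fun j _ => ?_
        rw [rpow_natCast, mul_pow]
        ring
      · ring
    · ring
  have hsum : IntegrableOn
      (fun τ => ∑ j ∈ range (n + 1), T ^ j / j.factorial * a j * (w τ * τ ^ (j : ℝ)))
      (Ioo 0 1) :=
    integrable_finsetSum _ fun j _ => hw j.cast_nonneg _
  have hzero : ∀ j ∈ range (n + 1),
      ∫ τ in Ioo (0 : ℝ) 1, T ^ j / j.factorial * a j * (w τ * τ ^ (j : ℝ)) = 0 := by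
    intro j hj
    rw [integral_const_mul, hI j.cast_nonneg,
      descPochhammer_eval_coe_nat_of_lt (mem_range.mp hj)]
    simp
  have hint : ∫ τ in (0 : ℝ)..1, w τ * x (t₀ + T * τ)
      = T ^ α / Gamma (α + 1) * b * ((descPochhammer ℝ (n + 1)).eval α / (n + 1).factorial
          * betaFn (α + κ + 1) (n + ν + 2))
        + T ^ (2 * α - n) / Gamma (2 * α - n + 1) * c
          * ((descPochhammer ℝ (n + 1)).eval (2 * α - n) / (n + 1).factorial
          * betaFn (2 * α - n + κ + 1) (n + ν + 2)) := by
    rw [intervalIntegral.integral_of_le zero_le_one, integral_Ioc_eq_integral_Ioo,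
      setIntegral_congr_fun measurableSet_Ioo hexp,
      integral_add (Integrable.fun_add hsum (hw hα0 _)) (hw hβ0 _), integral_add hsum (hw hα0 _),
      integral_finsetSum _ fun j _ => hw j.cast_nonneg _, sum_eq_zero hzero,
      integral_const_mul, integral_const_mul, hI hα0, hI hβ0, zero_add]
  have hg1 : Gamma (α + 1) = (descPochhammer ℝ (n + 1)).eval α * Gamma (α - n) := by
    rw [Gamma_add_one_eq_descPochhammer_mul α (n + 1) (by push_cast; linarith)]
    push_cast
    congr 2
    ring
  have hg2 : Gamma (2 * α - n + 1)
      = (descPochhammer ℝ (n + 1)).eval (2 * α - n) * Gamma (2 * (α - n)) := by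
    rw [Gamma_add_one_eq_descPochhammer_mul (2 * α - n) (n + 1) (by push_cast; linarith)]
    push_cast
    congr 2
    ring
  have hd1 : (descPochhammer ℝ (n + 1)).eval α ≠ 0 :=
    (descPochhammer_pos (by push_cast; linarith)).ne'
  have hd2 : (descPochhammer ℝ (n + 1)).eval (2 * α - n) ≠ 0 :=
    (descPochhammer_pos (by push_cast; linarith)).ne'
  have hG1 : Gamma (α - n) ≠ 0 := (Gamma_pos_of_pos (by linarith)).ne'
  have hG2 : Gamma (2 * (α - n)) ≠ 0 := (Gamma_pos_of_pos (by linarith)).ne'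
  have hB : betaFn (α + 1 + κ) (n + ν + 2) ≠ 0 :=
    (betaFn_pos (by linarith) (by linarith)).ne'
  have hTα : T ^ α ≠ 0 := (rpow_pos_of_pos hT α).ne'
  have hfac : ((n + 1).factorial : ℝ) ≠ 0 := by exact_mod_cast (n + 1).factorial_ne_zero
  rw [minDiff, hint, hg1, hg2, add_right_comm α κ 1]
  generalize (descPochhammer ℝ (n + 1)).eval (2 * α - n) = d at hd2 ⊢
  generalize Gamma (2 * (α - n)) = g at hG2 ⊢
  field_simp

theorem betaFn_add_one_div_betaFn_add_one {p q r : ℝ} (hp : 0 < p) (hq : 0 < q) (hr : 0 < r) :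
    betaFn (p + 1) r / betaFn (q + 1) r
      = p / q * (betaFn p (r + 1) / betaFn q (r + 1)) := by
  have h1 := (Gamma_pos_of_pos hp).ne'
  have h2 := (Gamma_pos_of_pos hq).ne'
  have h3 := (Gamma_pos_of_pos hr).ne'
  have h4 := (Gamma_pos_of_pos (show 0 < p + (r + 1) by linarith)).ne'
  have h5 := (Gamma_pos_of_pos (show 0 < q + (r + 1) by linarith)).ne'
  rw [betaFn, betaFn, betaFn, betaFn, add_right_comm p 1 r, add_right_comm q 1 r, add_assoc p,
    add_assoc q, Gamma_add_one hp.ne', Gamma_add_one hq.ne', Gamma_add_one hr.ne']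
  field_simp

/-- Proposition 3, time-domain form: the affine Jacobi fractional differentiator
is exact on the second-order truncated fractional Taylor model. -/
theorem affine_jacobi_fractional_differentiator_exact
    (n k : ℕ) (μ α : ℝ) (hμ : -1 < μ) (hα1 : (n : ℝ) < α) (hα2 : α ≤ n + 1)
    (T : ℝ) (hT : 0 < T) (t₀ : ℝ) (a : ℕ → ℝ) (b c : ℝ) (x : ℝ → ℝ)
    (hx : ∀ t : ℝ, 0 ≤ t →
      x (t₀ + t) = (∑ j ∈ Finset.range (n + 1), t ^ j / (Nat.factorial j) * a j)
        + t ^ α / Real.Gamma (α + 1) * b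
        + t ^ (2 * α - n) / Real.Gamma (2 * α - n + 1) * c) :
    (2 * α - n + 1 + k) / (α - n) * minDiff n α T t₀ k (μ + 1) x
      + (1 - (2 * α - n + 1 + k) / (α - n)) * minDiff n α T t₀ (k + 1) μ x = b := by
  have hn : (0 : ℝ) ≤ n := n.cast_nonneg
  have hk : (0 : ℝ) ≤ k := k.cast_nonneg
  have hα : α - n ≠ 0 := by linarith
  have hq : α + k + 1 ≠ 0 := by linarith
  rw [minDiff_eq_add (by linarith) (by linarith) hα1 hT hx,
    minDiff_eq_add (by linarith) hμ hα1 hT hx,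
    show 2 * α - n + (k + 1 : ℝ) + 1 = (2 * α - n + k + 1) + 1 by ring,
    show α + 1 + (k + 1 : ℝ) = (α + k + 1) + 1 by ring,
    betaFn_add_one_div_betaFn_add_one (by linarith) (by linarith) (by linarith),
    show (n : ℝ) + (μ + 1) + 2 = n + μ + 2 + 1 by ring, add_right_comm α 1 (k : ℝ)]
  field_simp
  ring
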